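/- arXiv:2504.10897 — 7 statements merged into one kernel-verified Lean document; each statement's English description precedes it below -/
import Mathlib

section
/- For every finite simple undirected graph G = (V, E) and every natural number k, G has a dominating set of size k if and only if there exists a subset PD ⊆ V whose profit equals |V| − k. -/
/-- A vertex `v` is dominated by a set `S` of vertices if `v ∈ S` or `v` is
adjacent to some vertex of `S`. -/
def Dominated {V : Type*} (G : SimpleGraph V) (S : Finset V) (v : V) : Prop :=
  v ∈ S ∨ ∃ u ∈ S, G.Adj v u

/-- A dominating set is a set of vertices dominating every vertex. -/
def IsDominatingSet {V : Type*} [Fintype V] (G : SimpleGraph V) (S : Finset V) : Prop :=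
  ∀ v : V, Dominated G S v

open Classical in
/-- The profit of a subset `PD` of vertices: the number of vertices dominated
by `PD`, minus `|PD|`. -/
noncomputable def profit {V : Type*} [Fintype V] (G : SimpleGraph V) (PD : Finset V) : ℤ :=
  ((Finset.univ.filter (fun v => Dominated G PD v)).card : ℤ) - PD.card

theorem minds_iff_maxpd {V : Type*} [Fintype V] (G : SimpleGraph V) (k : ℕ) :
    (∃ DS : Finset V, IsDominatingSet G DS ∧ DS.card = k) ↔
      (∃ PD : Finset V, profit G PD = (Fintype.card V : ℤ) - k) := by
  classical
  constructor
  · rintro ⟨DS, hDS, rfl⟩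
    refine ⟨DS, ?_⟩
    rw [profit, Finset.filter_true_of_mem fun v _ => hDS v, Finset.card_univ]
  · rintro ⟨PD, hPD⟩
    refine ⟨PD ∪ Finset.univ.filter (fun v => ¬ Dominated G PD v), fun v => ?_, ?_⟩
    · by_cases hv : Dominated G PD v
      · rcases hv with hv | ⟨u, hu, huv⟩
        · exact Or.inl (Finset.mem_union_left _ hv)
        · exact Or.inr ⟨u, Finset.mem_union_left _ hu, huv⟩
      · exact Or.inl (Finset.mem_union_right _ (by simpa using hv))
    · have hdisj : Disjoint PD (Finset.univ.filter (fun v => ¬ Dominated G PD v)) :=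
        Finset.disjoint_left.2 fun v hv hv' => (Finset.mem_filter.1 hv').2 (Or.inl hv)
      have hsum := Finset.card_filter_add_card_filter_not
        (s := (Finset.univ : Finset V)) (Dominated G PD)
      rw [Finset.card_univ] at hsum
      rw [profit] at hPD
      rw [Finset.card_union_of_disjoint hdisj]
      lia
end

section
/- For every finite simple undirected graph G = (V, E) and every subset PD ⊆ V, there exists a dominating set DS of G with PD ⊆ DS and |DS| ≤ |V| − p(PD), where p(PD) is the profit of PD. -/
theorem exists_dominating_superset {V : Type*} [Fintype V] (G : SimpleGraph V)
    (PD : Finset V) :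
    ∃ DS : Finset V, IsDominatingSet G DS ∧ PD ⊆ DS ∧
      (DS.card : ℤ) ≤ (Fintype.card V : ℤ) - profit G PD := by
  classical
  refine ⟨PD ∪ Finset.univ.filter (fun v => ¬ Dominated G PD v), fun v => ?_,
    Finset.subset_union_left, ?_⟩
  · by_cases hv : Dominated G PD v
    · rcases hv with hv | ⟨u, hu, huv⟩
      · exact Or.inl (Finset.mem_union_left _ hv)
      · exact Or.inr ⟨u, Finset.mem_union_left _ hu, huv⟩
    · exact Or.inl (Finset.mem_union_right _ (by simpa using hv))
  · have hunion := Finset.card_union_le PD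
      (Finset.univ.filter (fun v => ¬ Dominated G PD v))
    have hsplit := Finset.card_filter_add_card_filter_not (s := Finset.univ)
      (fun v => Dominated G PD v)
    rw [Finset.card_univ] at hsplit
    have hprofit : profit G PD =
        ((Finset.univ.filter (fun v => Dominated G PD v)).card : ℤ) - PD.card := by
      unfold profit
      congr!
    omega
end

section
/- For every finite simple undirected graph G = (V, E) and every subset F ⊆ E, there exists an edge dominating set F′ of G with F ⊆ F′ and |F′| ≤ |E| − p(F), where p(F) is the profit of F. -/
/-- An edge `e` is covered by a set of edges `F` if `e ∈ F` or `e` shares an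
endpoint with some edge of `F`. -/
def EdgeCovered {V : Type*} (F : Finset (Sym2 V)) (e : Sym2 V) : Prop :=
  e ∈ F ∨ ∃ f ∈ F, ∃ v : V, v ∈ e ∧ v ∈ f

/-- A set of edges is a matching if its edges are pairwise non-adjacent
(no two distinct edges share an endpoint). -/
def IsMatchingSet {V : Type*} (M : Finset (Sym2 V)) : Prop :=
  ∀ e ∈ M, ∀ f ∈ M, e ≠ f → ∀ v : V, ¬ (v ∈ e ∧ v ∈ f)

/-- A maximal matching of `G`: a matching consisting of edges of `G` to which
no further edge of `G` can be added while keeping it a matching. -/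
def IsMaximalMatching {V : Type*} [Fintype V] [DecidableEq V] (G : SimpleGraph V)
    [DecidableRel G.Adj] (M : Finset (Sym2 V)) : Prop :=
  M ⊆ G.edgeFinset ∧ IsMatchingSet M ∧
    ∀ e ∈ G.edgeFinset, e ∉ M → ¬ IsMatchingSet (insert e M)

/-- An edge dominating set of `G`: a set of edges of `G` covering every edge of `G`. -/
def IsEdgeDominatingSet {V : Type*} [Fintype V] [DecidableEq V] (G : SimpleGraph V)
    [DecidableRel G.Adj] (F : Finset (Sym2 V)) : Prop :=
  F ⊆ G.edgeFinset ∧ ∀ e ∈ G.edgeFinset, EdgeCovered F e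

open Classical in
/-- The profit of a subset `F` of the edges of `G`: the number of edges of `G`
covered by `F`, minus `|F|`. -/
noncomputable def edgeProfit {V : Type*} [Fintype V] [DecidableEq V] (G : SimpleGraph V)
    [DecidableRel G.Adj] (F : Finset (Sym2 V)) : ℤ :=
  ((G.edgeFinset.filter (fun e => EdgeCovered F e)).card : ℤ) - F.card
theorem exists_edge_dominating_superset {V : Type*} [Fintype V] [DecidableEq V]
    (G : SimpleGraph V) [DecidableRel G.Adj] (F : Finset (Sym2 V))
    (hF : F ⊆ G.edgeFinset) :
    ∃ F' : Finset (Sym2 V), IsEdgeDominatingSet G F' ∧ F ⊆ F' ∧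
      (F'.card : ℤ) ≤ (G.edgeFinset.card : ℤ) - edgeProfit G F := by
  classical
  refine ⟨F ∪ G.edgeFinset.filter (fun e => ¬ EdgeCovered F e), ⟨?_, ?_⟩,
    Finset.subset_union_left, ?_⟩
  · exact Finset.union_subset hF (Finset.filter_subset _ _)
  · intro e he
    by_cases h : EdgeCovered F e
    · rcases h with h | ⟨f, hf, v, hv⟩
      · exact Or.inl (Finset.mem_union_left _ h)
      · exact Or.inr ⟨f, Finset.mem_union_left _ hf, v, hv⟩
    · exact Or.inl (Finset.mem_union_right _ (Finset.mem_filter.mpr ⟨he, h⟩))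
  · have hunion := Finset.card_union_le F (G.edgeFinset.filter (fun e => ¬ EdgeCovered F e))
    have hsplit := Finset.card_filter_add_card_filter_not (s := G.edgeFinset)
      (fun e => EdgeCovered F e)
    have hprofit : edgeProfit G F =
        ((G.edgeFinset.filter (fun e => EdgeCovered F e)).card : ℤ) - F.card := by
      unfold edgeProfit
      congr!
    omega
end

section
/- For every finite simple undirected graph G = (V, E) and every edge dominating set D ⊆ E of G, there exists a maximal matching M of G with |M| ≤ |D|. -/
theorem isEdgeDominatingSet_iff {V : Type*} [Fintype V] [DecidableEq V] (G : SimpleGraph V)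
    [DecidableRel G.Adj] (F : Finset (Sym2 V)) :
    IsEdgeDominatingSet G F ↔ F ⊆ G.edgeFinset ∧
      ∀ a b, G.Adj a b → (∃ f ∈ F, a ∈ f) ∨ ∃ f ∈ F, b ∈ f := by
  refine and_congr_right fun _ => ⟨fun h a b hab => ?_, fun h e he => ?_⟩
  · rcases h s(a, b) (by simpa using hab) with h | ⟨f, hf, v, hv, hvf⟩
    · exact Or.inl ⟨_, h, Sym2.mem_mk_left a b⟩
    · rcases Sym2.mem_iff.1 hv with rfl | rfl
      · exact Or.inl ⟨f, hf, hvf⟩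
      · exact Or.inr ⟨f, hf, hvf⟩
  · induction e with | _ a b
    rcases h a b (by simpa using he) with ⟨f, hf, h⟩ | ⟨f, hf, h⟩
    · exact Or.inr ⟨f, hf, a, Sym2.mem_mk_left a b, h⟩
    · exact Or.inr ⟨f, hf, b, Sym2.mem_mk_right a b, h⟩

/-- The vertices that are not an endpoint of any edge of `F`. -/
def unmatchedVertices {V : Type*} [Fintype V] [DecidableEq V] (F : Finset (Sym2 V)) : Finset V :=
  Finset.univ.filter fun v => ∀ f ∈ F, v ∉ f

theorem IsEdgeDominatingSet.isMaximalMatching {V : Type*} [Fintype V] [DecidableEq V]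
    {G : SimpleGraph V} [DecidableRel G.Adj] {F : Finset (Sym2 V)}
    (hF : IsEdgeDominatingSet G F) (hM : IsMatchingSet F) : IsMaximalMatching G F := by
  refine ⟨hF.1, hM, fun e he heF h => ?_⟩
  rcases hF.2 e he with h' | ⟨f, hf, v, hv, hvf⟩
  · exact heF h'
  · exact h e (Finset.mem_insert_self _ _) f (Finset.mem_insert_of_mem hf)
      (fun hef => heF (hef ▸ hf)) v ⟨hv, hvf⟩

/-- Two adjacent edges in an edge dominating set allow one of them to be deleted, or to be
exchanged for an edge that reaches a new vertex. -/
theorem IsEdgeDominatingSet.exists_improvement {V : Type*} [Fintype V] [DecidableEq V]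
    {G : SimpleGraph V} [DecidableRel G.Adj] {F : Finset (Sym2 V)}
    (hF : IsEdgeDominatingSet G F) (hM : ¬ IsMatchingSet F) :
    ∃ F', IsEdgeDominatingSet G F' ∧ F'.card ≤ F.card ∧
      2 * F'.card + (unmatchedVertices F').card < 2 * F.card + (unmatchedVertices F).card := by
  simp only [IsMatchingSet, not_forall, not_not] at hM
  obtain ⟨f, hf, g, hg, hfg, u, huf, hug⟩ := hM
  obtain ⟨w, rfl⟩ := hug
  rw [isEdgeDominatingSet_iff] at hF
  obtain ⟨hsub, hcov⟩ := hF
  have hf' : f ∈ F.erase s(u, w) := Finset.mem_erase.2 ⟨hfg, hf⟩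
  have hcard := Finset.card_erase_add_one hg
  have hkeep : ∀ a, a ≠ w → (∃ e ∈ F, a ∈ e) → ∃ e ∈ F.erase s(u, w), a ∈ e := by
    rintro a haw ⟨e, he, hae⟩
    by_cases heg : e = s(u, w)
    · subst heg
      rcases Sym2.mem_iff.1 hae with rfl | rfl
      · exact ⟨f, hf', huf⟩
      · exact absurd rfl haw
    · exact ⟨e, Finset.mem_erase.2 ⟨heg, he⟩, hae⟩
  by_cases hw : ∀ x, G.Adj w x → ∃ e ∈ F.erase s(u, w), x ∈ e
  · refine ⟨F.erase s(u, w), ?_, by omega, ?_⟩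
    · rw [isEdgeDominatingSet_iff]
      refine ⟨(Finset.erase_subset _ _).trans hsub, fun a b hab => ?_⟩
      by_cases ha : a = w
      · subst ha
        exact Or.inr (hw b hab)
      by_cases hb : b = w
      · subst hb
        exact Or.inl (hw a hab.symm)
      exact (hcov a b hab).imp (hkeep a ha) (hkeep b hb)
    · have hle : unmatchedVertices (F.erase s(u, w)) ⊆ insert w (unmatchedVertices F) := by
        intro a ha
        by_contra hcon
        simp only [unmatchedVertices, Finset.mem_insert, Finset.mem_filter, Finset.mem_univ,
          true_and, not_or, not_forall, not_not] at ha hcon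
        obtain ⟨haw, e, he, hae⟩ := hcon
        obtain ⟨e', he', hae'⟩ := hkeep a haw ⟨e, he, hae⟩
        exact ha e' he' hae'
      have := (Finset.card_le_card hle).trans (Finset.card_insert_le _ _)
      omega
  · push Not at hw
    obtain ⟨x, hwx, hx⟩ := hw
    have hkeep' : ∀ a, (∃ e ∈ F, a ∈ e) → ∃ e ∈ insert s(w, x) (F.erase s(u, w)), a ∈ e := by
      intro a ha
      by_cases haw : a = w
      · exact ⟨_, Finset.mem_insert_self _ _, haw ▸ Sym2.mem_mk_left w x⟩
      · obtain ⟨e, he, hae⟩ := hkeep a haw ha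
        exact ⟨e, Finset.mem_insert_of_mem he, hae⟩
    have hle := Finset.card_insert_le s(w, x) (F.erase s(u, w))
    refine ⟨insert s(w, x) (F.erase s(u, w)), ?_, by omega, ?_⟩
    · rw [isEdgeDominatingSet_iff]
      exact ⟨Finset.insert_subset (by simpa using hwx) ((Finset.erase_subset _ _).trans hsub),
        fun a b hab => (hcov a b hab).imp (hkeep' a) (hkeep' b)⟩
    · have hlt : unmatchedVertices (insert s(w, x) (F.erase s(u, w))) ⊂ unmatchedVertices F := by
        rw [Finset.ssubset_iff_of_subset]
        · refine ⟨x, ?_, ?_⟩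
          · simp only [unmatchedVertices, Finset.mem_filter, Finset.mem_univ, true_and]
            intro e he hxe
            obtain ⟨e', he', hxe'⟩ := hkeep x hwx.ne' ⟨e, he, hxe⟩
            exact hx e' he' hxe'
          · simp [unmatchedVertices]
        · intro a ha
          simp only [unmatchedVertices, Finset.mem_filter, Finset.mem_univ, true_and] at ha ⊢
          intro e he hae
          obtain ⟨e', he', hae'⟩ := hkeep' a ⟨e, he, hae⟩
          exact ha e' he' hae'
      have := Finset.card_lt_card hlt
      omega

theorem exists_maximal_matching_le_eds {V : Type*} [Fintype V] [DecidableEq V]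
    (G : SimpleGraph V) [DecidableRel G.Adj] (D : Finset (Sym2 V))
    (hD : IsEdgeDominatingSet G D) :
    ∃ M : Finset (Sym2 V), IsMaximalMatching G M ∧ M.card ≤ D.card := by
  induction hn : 2 * D.card + (unmatchedVertices D).card using Nat.strong_induction_on
    generalizing D with
  | _ n ih =>
    by_cases hM : IsMatchingSet D
    · exact ⟨D, hD.isMaximalMatching hM, le_rfl⟩
    · obtain ⟨F, hF, hcard, hlt⟩ := hD.exists_improvement hM
      obtain ⟨M, hMM, hle⟩ := ih _ (hn ▸ hlt) F hF rfl
      exact ⟨M, hMM, hle.trans hcard⟩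
end

section
/- For every finite simple undirected graph G = (V, E), the minimum size of a maximal matching of G equals the minimum size of an edge dominating set of G. -/
open Classical in
/-- The vertices that are endpoints of some edge of `F`. -/
noncomputable def coveredVertices {V : Type*} [Fintype V] (F : Finset (Sym2 V)) : Finset V :=
  Finset.univ.filter (fun v => ∃ e ∈ F, v ∈ e)

theorem mem_coveredVertices {V : Type*} [Fintype V] {F : Finset (Sym2 V)} {v : V} :
    v ∈ coveredVertices F ↔ ∃ e ∈ F, v ∈ e := by
  simp [coveredVertices]

theorem edgeCovered_iff {V : Type*} [Fintype V] {F : Finset (Sym2 V)} {e : Sym2 V} :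
    EdgeCovered F e ↔ ∃ v ∈ e, v ∈ coveredVertices F := by
  simp only [EdgeCovered, mem_coveredVertices]
  constructor
  · rintro (h | ⟨f, hf, v, hv, hvf⟩)
    · exact ⟨e.out.1, e.out_fst_mem, e, h, e.out_fst_mem⟩
    · exact ⟨v, hv, f, hf, hvf⟩
  · rintro ⟨v, hv, f, hf, hvf⟩
    exact Or.inr ⟨f, hf, v, hv, hvf⟩

section

variable {V : Type*} [Fintype V] [DecidableEq V] {G : SimpleGraph V} [DecidableRel G.Adj]
  {D M : Finset (Sym2 V)}

theorem IsMaximalMatching.isEdgeDominatingSet (h : IsMaximalMatching G M) :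
    IsEdgeDominatingSet G M := by
  obtain ⟨hMG, hM, hmax⟩ := h
  refine ⟨hMG, fun e he => ?_⟩
  by_contra hc
  simp only [EdgeCovered, not_or, not_exists, not_and] at hc
  obtain ⟨heM, hc⟩ := hc
  refine hmax e he heM fun a ha b hb hab v hv => ?_
  rcases Finset.mem_insert.1 ha with rfl | haM <;> rcases Finset.mem_insert.1 hb with rfl | hbM
  · exact hab rfl
  · exact hc b hbM v hv.1 hv.2
  · exact hc a haM v hv.2 hv.1
  · exact hM a haM b hbM hab v hv

theorem IsEdgeDominatingSet.isMaximalMatching_s12 (h : IsEdgeDominatingSet G D)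
    (hD : IsMatchingSet D) : IsMaximalMatching G D := by
  refine ⟨h.1, hD, fun e he heD hins => ?_⟩
  rcases h.2 e he with h | ⟨f, hf, v, hve, hvf⟩
  · exact heD h
  · exact hins e (by simp) f (by simp [hf]) (by rintro rfl; exact heD hf) v ⟨hve, hvf⟩

/-- If `D` is an edge dominating set containing adjacent edges and no edge dominating set is
smaller, then one of these edges can be exchanged so that more vertices are covered. -/
theorem IsEdgeDominatingSet.exists_card_coveredVertices_lt (h : IsEdgeDominatingSet G D)
    (hmin : ∀ D', IsEdgeDominatingSet G D' → D.card ≤ D'.card) (hD : ¬ IsMatchingSet D) :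
    ∃ D', IsEdgeDominatingSet G D' ∧ D'.card = D.card ∧
      (coveredVertices D).card < (coveredVertices D').card := by
  simp only [IsMatchingSet, not_forall, not_not] at hD
  obtain ⟨e, he, f, hf, hef, u, hue, huf⟩ := hD
  have heD : e ∈ D.erase f := Finset.mem_erase.2 ⟨hef, he⟩
  have hnot : ¬ IsEdgeDominatingSet G (D.erase f) := fun h' =>
    (Finset.card_erase_lt_of_mem hf).not_ge (hmin _ h')
  obtain ⟨g, hg, hgc⟩ : ∃ g ∈ G.edgeFinset, ¬ EdgeCovered (D.erase f) g := by
    by_contra! hc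
    exact hnot ⟨(Finset.erase_subset _ _).trans h.1, hc⟩
  have hgv : ∀ v ∈ g, v ∉ coveredVertices (D.erase f) := fun v hv hv' =>
    hgc (edgeCovered_iff.2 ⟨v, hv, hv'⟩)
  have hu : u ∈ coveredVertices (D.erase f) := mem_coveredVertices.2 ⟨e, heD, hue⟩
  obtain ⟨w, hwg, hwD⟩ := edgeCovered_iff.1 (h.2 g hg)
  have hwf : w ∈ f := by
    obtain ⟨k, hk, hwk⟩ := mem_coveredVertices.1 hwD
    by_cases hkf : k = f
    · exact hkf ▸ hwk
    · exact absurd (mem_coveredVertices.2 ⟨k, Finset.mem_erase.2 ⟨hkf, hk⟩, hwk⟩) (hgv w hwg)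
  have hwu : w ≠ u := by
    rintro rfl
    exact hgv w hwg hu
  have hf_eq : f = s(w, u) := (Sym2.mem_and_mem_iff hwu).1 ⟨hwf, huf⟩
  obtain ⟨x, rfl⟩ := hwg
  have hwx : w ≠ x := by
    rintro rfl
    simp at hg
  have hxg : x ∈ s(w, x) := Sym2.mem_mk_right w x
  have hxD : x ∉ coveredVertices D := fun hx => by
    obtain ⟨k, hk, hxk⟩ := mem_coveredVertices.1 hx
    by_cases hkf : k = f
    · subst hkf
      rw [hf_eq, Sym2.mem_iff] at hxk
      rcases hxk with rfl | rfl
      · exact hwx rfl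
      · exact hgv x hxg hu
    · exact hgv x hxg (mem_coveredVertices.2 ⟨k, Finset.mem_erase.2 ⟨hkf, hk⟩, hxk⟩)
  have hgD : s(w, x) ∉ D.erase f := fun hg' => hgc (Or.inl hg')
  have hsub : coveredVertices D ⊆ coveredVertices (insert s(w, x) (D.erase f)) := by
    intro v hv
    obtain ⟨k, hk, hvk⟩ := mem_coveredVertices.1 hv
    rw [mem_coveredVertices]
    by_cases hkf : k = f
    · rw [hkf, hf_eq, Sym2.mem_iff] at hvk
      rcases hvk with rfl | rfl
      · exact ⟨s(v, x), Finset.mem_insert_self _ _, Sym2.mem_mk_left v x⟩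
      · exact ⟨e, Finset.mem_insert_of_mem heD, hue⟩
    · exact ⟨k, Finset.mem_insert_of_mem (Finset.mem_erase.2 ⟨hkf, hk⟩), hvk⟩
  refine ⟨insert s(w, x) (D.erase f), ⟨?_, fun k hk => ?_⟩, ?_, ?_⟩
  · exact Finset.insert_subset hg ((Finset.erase_subset _ _).trans h.1)
  · obtain ⟨v, hv, hvD⟩ := edgeCovered_iff.1 (h.2 k hk)
    exact edgeCovered_iff.2 ⟨v, hv, hsub hvD⟩
  · rw [Finset.card_insert_of_notMem hgD, Finset.card_erase_add_one hf]
  · refine Finset.card_lt_card ((Finset.ssubset_iff_of_subset hsub).2 ⟨x, ?_, hxD⟩)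
    exact mem_coveredVertices.2 ⟨_, Finset.mem_insert_self _ _, hxg⟩

theorem isEdgeDominatingSet_edgeFinset : IsEdgeDominatingSet G G.edgeFinset :=
  ⟨Finset.Subset.refl _, fun _ he => Or.inl he⟩

variable (G) in
/-- Some edge dominating set of minimum size is a maximal matching. -/
theorem exists_isMaximalMatching_card_le :
    ∃ M, IsMaximalMatching G M ∧ ∀ D, IsEdgeDominatingSet G D → M.card ≤ D.card := by
  classical
  obtain ⟨D₀, hD₀, hmin⟩ := Finset.exists_min_image
    (Finset.univ.filter (IsEdgeDominatingSet G)) Finset.card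
    ⟨G.edgeFinset, by simpa using isEdgeDominatingSet_edgeFinset⟩
  simp only [Finset.mem_filter_univ] at hD₀ hmin
  obtain ⟨D, hD, hmax⟩ := Finset.exists_max_image
    (Finset.univ.filter fun D => IsEdgeDominatingSet G D ∧ D.card = D₀.card)
    (fun D => (coveredVertices D).card) ⟨D₀, by simpa using hD₀⟩
  simp only [Finset.mem_filter_univ] at hD hmax
  have hDmin : ∀ D', IsEdgeDominatingSet G D' → D.card ≤ D'.card := fun D' h' =>
    hD.2 ▸ hmin D' h'
  refine ⟨D, hD.1.isMaximalMatching_s12 ?_, hDmin⟩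
  by_contra hDm
  obtain ⟨D', hD', hcard, hlt⟩ := hD.1.exists_card_coveredVertices_lt hDmin hDm
  exact hlt.not_ge (hmax D' ⟨hD', hcard.trans hD.2⟩)

end

theorem min_maximal_matching_eq_min_eds {V : Type*} [Fintype V] [DecidableEq V]
    (G : SimpleGraph V) [DecidableRel G.Adj] (hE : G.edgeFinset.Nonempty) :
    sInf {k : ℕ | ∃ M : Finset (Sym2 V), IsMaximalMatching G M ∧ M.card = k} =
      sInf {k : ℕ | ∃ D : Finset (Sym2 V), IsEdgeDominatingSet G D ∧ D.card = k} := by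
  obtain ⟨M, hM, hmin⟩ := exists_isMaximalMatching_card_le G
  have hleft : IsLeast {k : ℕ | ∃ M : Finset (Sym2 V), IsMaximalMatching G M ∧ M.card = k}
      M.card := by
    refine ⟨⟨M, hM, rfl⟩, ?_⟩
    rintro _ ⟨M', hM', rfl⟩
    exact hmin M' hM'.isEdgeDominatingSet
  have hright : IsLeast {k : ℕ | ∃ D : Finset (Sym2 V), IsEdgeDominatingSet G D ∧ D.card = k}
      M.card := by
    refine ⟨⟨M, hM.isEdgeDominatingSet, rfl⟩, ?_⟩
    rintro _ ⟨D, hD, rfl⟩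
    exact hmin D hD
  rw [hleft.csInf_eq, hright.csInf_eq]
end

section
/- For every finite universe U, every finite family 𝒞 of subsets of U whose union equals U, and every subfamily 𝒫 ⊆ 𝒞, there exists a set cover 𝒞′ ⊆ 𝒞 with 𝒫 ⊆ 𝒞′ and |𝒞′| ≤ |U| − p(𝒫), where p(𝒫) is the profit of 𝒫. -/
/-- The profit of a subfamily `P` of subsets: the size of the union of the
members of `P`, minus `|P|`. -/
def coverProfit {α : Type*} [DecidableEq α] (P : Finset (Finset α)) : ℤ :=
  ((P.biUnion id).card : ℤ) - P.card
theorem exists_set_cover_superset {α : Type*} [DecidableEq α] (U : Finset α)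
    (C : Finset (Finset α)) (hC : C.biUnion id = U)
    (P : Finset (Finset α)) (hP : P ⊆ C) :
    ∃ C' : Finset (Finset α), C' ⊆ C ∧ C'.biUnion id = U ∧ P ⊆ C' ∧
      (C'.card : ℤ) ≤ (U.card : ℤ) - coverProfit P := by
  have hex : ∀ u : α, ∃ c : Finset α, u ∈ U → c ∈ C ∧ u ∈ c := by
    intro u
    by_cases hu : u ∈ U
    · rw [← hC, Finset.mem_biUnion] at hu
      obtain ⟨c, hc, huc⟩ := hu
      exact ⟨c, fun _ => ⟨hc, huc⟩⟩
    · exact ⟨∅, fun h => absurd h hu⟩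
  choose f hf using hex
  have hPU : P.biUnion id ⊆ U :=
    (Finset.biUnion_subset_biUnion_of_subset_left id hP).trans hC.subset
  have hsub : P ∪ (U \ P.biUnion id).image f ⊆ C := by
    refine Finset.union_subset hP (Finset.image_subset_iff.2 fun u hu => ?_)
    exact (hf u (Finset.mem_sdiff.1 hu).1).1
  refine ⟨P ∪ (U \ P.biUnion id).image f, hsub, ?_, Finset.subset_union_left, ?_⟩
  · apply Finset.Subset.antisymm
    · exact (Finset.biUnion_subset_biUnion_of_subset_left id hsub).trans hC.subset
    · intro u hu
      rw [Finset.union_biUnion, Finset.mem_union]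
      by_cases h : u ∈ P.biUnion id
      · exact Or.inl h
      · exact Or.inr (Finset.mem_biUnion.2 ⟨f u,
          Finset.mem_image_of_mem f (Finset.mem_sdiff.2 ⟨hu, h⟩), (hf u hu).2⟩)
  · have h₁ := Finset.card_union_le P ((U \ P.biUnion id).image f)
    have h₂ := Finset.card_image_le (s := U \ P.biUnion id) (f := f)
    have h₃ := Finset.card_sdiff_add_card_eq_card hPU
    unfold coverProfit
    omega
end

section
/- For every finite universe U and every finite family 𝒞 of subsets of U whose union equals U, the maximum of the profit p(𝒫) over all subfamilies 𝒫 ⊆ 𝒞 equals |U| minus the minimum size of a set cover 𝒞′ ⊆ 𝒞. -/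
/-- Every subfamily of a finite family extends to a cover by adding at most one set
for each element it leaves uncovered. -/
theorem exists_cover_superset_card_le {α : Type*} [DecidableEq α]
    {P C : Finset (Finset α)} (hP : P ⊆ C) :
    ∃ C' : Finset (Finset α), P ⊆ C' ∧ C' ⊆ C ∧ C'.biUnion id = C.biUnion id ∧
      C'.card ≤ P.card + (C.biUnion id \ P.biUnion id).card := by
  have h : ∀ x ∈ C.biUnion id, ∃ S ∈ C, x ∈ S := by
    simp
  choose! f hfC hxf using h
  have hsub : P ∪ (C.biUnion id \ P.biUnion id).image f ⊆ C := by
    refine Finset.union_subset hP (Finset.image_subset_iff.2 fun x hx => ?_)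
    exact hfC x (Finset.mem_sdiff.1 hx).1
  refine ⟨_, Finset.subset_union_left, hsub,
    (Finset.biUnion_subset_biUnion_of_subset_left id hsub).antisymm fun x hx => ?_, ?_⟩
  · by_cases hxP : x ∈ P.biUnion id
    · exact Finset.biUnion_subset_biUnion_of_subset_left id Finset.subset_union_left hxP
    · refine Finset.mem_biUnion.2 ⟨f x, Finset.mem_union_right _ ?_, hxf x hx⟩
      exact Finset.mem_image_of_mem f (Finset.mem_sdiff.2 ⟨hx, hxP⟩)
  · exact (Finset.card_union_le _ _).trans (Nat.add_le_add_left Finset.card_image_le _)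

theorem max_coverProfit_eq_card_sub_min_cover {α : Type*} [DecidableEq α] (U : Finset α)
    (C : Finset (Finset α)) (hC : C.biUnion id = U) :
    (C.powerset.sup' (Finset.powerset_nonempty _) coverProfit) =
      (U.card : ℤ) -
        ((sInf {k : ℕ | ∃ C' : Finset (Finset α),
            C' ⊆ C ∧ C'.biUnion id = U ∧ C'.card = k} : ℕ) : ℤ) := by
  subst hC
  apply le_antisymm
  · refine Finset.sup'_le _ _ fun P hP => ?_
    rw [Finset.mem_powerset] at hP
    obtain ⟨C', -, hC', hcover, hcard⟩ := exists_cover_superset_card_le hP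
    have hmin : sInf {k : ℕ | ∃ C' : Finset (Finset α),
        C' ⊆ C ∧ C'.biUnion id = C.biUnion id ∧ C'.card = k} ≤ C'.card :=
      Nat.sInf_le ⟨C', hC', hcover, rfl⟩
    have hsdiff := Finset.card_sdiff_add_card_eq_card
      (Finset.biUnion_subset_biUnion_of_subset_left id hP)
    unfold coverProfit
    omega
  · obtain ⟨C', hC', hcover, hcard⟩ := Nat.sInf_mem
      (s := {k : ℕ | ∃ C' : Finset (Finset α),
        C' ⊆ C ∧ C'.biUnion id = C.biUnion id ∧ C'.card = k}) ⟨C.card, C, subset_rfl, rfl, rfl⟩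
    rw [← hcard, ← hcover]
    exact Finset.le_sup' coverProfit (Finset.mem_powerset.2 hC')
end
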